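/- Let (X, ρ, 𝒞) be a semi-Cartan graph with GRS Δ, Weyl groupoid 𝒲, and nil-Hecke algebra 𝒩 over a commutative ring 𝕂. Let u ∈ 𝒲(y,z) with ℓ(u) = m, let x ∈ X and i ∈ I. If z = ρ_i(x) and ℓ(σ_i^x u) = m + 1, then n_i^x T_u = T_{σ_i^x u}; otherwise (i.e. if z ≠ ρ_i(x), or if z = ρ_i(x) and ℓ(σ_i^x u) < m + 1), n_i^x T_u = 0. -/

import Mathlib

open CategoryTheory

noncomputable section

namespace WeylGroupoid

variable {θ : ℕ} {X : Type} [Fintype X] [DecidableEq X]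

/-- A *semi-Cartan graph*: a basic datum `(X, ρ)` together with a compatible bundle of
generalized Cartan matrices. -/
structure SCG (θ : ℕ) (X : Type) [Fintype X] [DecidableEq X] : Type where
  nonempty : Nonempty X
  /-- the involutions `ρ_i` of the basic datum -/
  ρ : Fin θ → X → X
  invol : ∀ i x, ρ i (ρ i x) = x
  /-- the bundle of generalized Cartan matrices `C^x` -/
  C : X → Fin θ → Fin θ → ℤ
  diag : ∀ x i, C x i i = 2
  offdiag : ∀ x i j, i ≠ j → C x i j ≤ 0
  zero_iff : ∀ x i j, i ≠ j → (C x i j = 0 ↔ C x j i = 0)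
  compat : ∀ x i j, C (ρ i x) i j = C x i j

/-- the simple root `α_i ∈ ℤ^θ` -/
def al (θ : ℕ) (i : Fin θ) : Fin θ → ℤ := Pi.single i 1

/-- the reflection `s_i^x` of `ℤ^θ`, `s_i^x (α_j) = α_j - c^x_{ij} α_i` -/
def srefl (G : SCG θ X) (x : X) (i : Fin θ) (v : Fin θ → ℤ) : Fin θ → ℤ :=
  fun k => v k - (if k = i then ∑ j, G.C x i j * v j else 0)

/-- the cone `ℕ₀ α_i + ℕ₀ α_j` -/
def pairCone (θ : ℕ) (i j : Fin θ) : Set (Fin θ → ℤ) :=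
  {v | ∃ a b : ℕ, v = (a : ℤ) • al θ i + (b : ℤ) • al θ j}

/-- A *generalized root system* on a semi-Cartan graph. -/
structure GRS (G : SCG θ X) : Type where
  /-- the root sets `Δ^x` -/
  Δ : X → Set (Fin θ → ℤ)
  pos_neg : ∀ x, Δ x = (Δ x ∩ {v | ∀ k, 0 ≤ v k}) ∪ (-(Δ x ∩ {v | ∀ k, 0 ≤ v k}))
  simple : ∀ x i, Δ x ∩ {v | ∃ c : ℤ, v = c • al θ i} = {al θ i, -al θ i}
  reflect : ∀ x i, (srefl G x i) '' Δ x = Δ (G.ρ i x)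
  pairFinite : ∀ x i j, (Δ x ∩ pairCone θ i j).Finite
  loop : ∀ x i j, (fun y => G.ρ i (G.ρ j y))^[(Δ x ∩ pairCone θ i j).ncard] x = x

variable (G : SCG θ X)

/-- The entries `m^x_{ij} = |Δ^x ∩ (ℕ₀α_i + ℕ₀α_j)|`. -/
def mnum (R : GRS G) (x : X) (i j : Fin θ) : ℕ := (R.Δ x ∩ pairCone θ i j).ncard

/-- the set of positive roots `Δ^x_+` -/
def posRoots (R : GRS G) (x : X) : Set (Fin θ → ℤ) := R.Δ x ∩ {v | ∀ k, 0 ≤ v k}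

/-- The objects of the Weyl groupoid (a type synonym for `X` carrying a quiver
structure depending on `G`). -/
def Obj (G : SCG θ X) : Type := X

instance : Quiver (Obj G) := ⟨fun a b => {i : Fin θ // G.ρ i (show X from b) = (show X from a)}⟩

/-- objects of the path category -/
def pob (x : X) : Paths (Obj G) := (x : X)

/-- the generating arrow `σ_i^x : ρ_i(x) → x` -/
def genArrow (x : X) (i : Fin θ) : pob G (G.ρ i x) ⟶ pob G x :=
  Quiver.Path.nil.cons (⟨i, rfl⟩ : (show Obj G from G.ρ i x) ⟶ (show Obj G from x))

/-- the source of the word `σ_{i_1}^x σ_{i_2} ⋯ σ_{i_m}` (with target `x`) -/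
def wsrc (G : SCG θ X) : List (Fin θ) → X → X
  | [], x => x
  | i :: l, x => wsrc G l (G.ρ i x)

/-- the path `σ_{i_1}^x σ_{i_2} ⋯ σ_{i_m} : wsrc(w,x) → x` in the free category -/
def pathOf (G : SCG θ X) : (w : List (Fin θ)) → (x : X) → (pob G (wsrc G w x) ⟶ pob G x)
  | [], _ => 𝟙 _
  | i :: l, x => (pathOf G l (G.ρ i x)) ≫ genArrow G x i


/-- transport a path along an equality of sources -/
def castSrc {a b c : X} (h : a = b) (f : pob G a ⟶ pob G c) : pob G b ⟶ pob G c := by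
  subst h; exact f

/-- the alternating word `[i, j, i, j, …]` of length `n` -/
def altWord (i j : Fin θ) : ℕ → List (Fin θ)
  | 0 => []
  | n + 1 => i :: altWord j i n

/-- The defining relations `(σ_i^x σ_j)^{m^x_{ij}} = id_x` of the Weyl groupoid. -/
inductive wrel (R : GRS G) : HomRel (Paths (Obj G))
  | rel (x : X) (i j : Fin θ)
      (h : wsrc G (altWord i j (2 * mnum G R x i j)) x = x) :
      wrel R (castSrc G h (pathOf G (altWord i j (2 * mnum G R x i j)) x))
        (𝟙 (pob G x))

variable (R : GRS G)

/-- The Weyl groupoid, as the quotient of the free category on the quiver of the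
`σ_i^x` by the relations `(σ_i^x σ_j)^{m^x_{ij}} = id_x` (every generator is invertible
in this quotient, so it is indeed a groupoid). -/
def W := CategoryTheory.Quotient (wrel G R)

instance : Category (W G R) := inferInstanceAs (Category (CategoryTheory.Quotient (wrel G R)))

/-- objects of the Weyl groupoid -/
def objW (x : X) : W G R := ⟨pob G x⟩

/-- hom-sets `𝒲(y, x)` of the Weyl groupoid -/
def homW (y x : X) := objW G R y ⟶ objW G R x

instance {y x : X} : CoeSort (homW G R y x) (objW G R y ⟶ objW G R x) := ⟨id⟩

/-- the morphism of the Weyl groupoid defined by the word `σ_{i_1}^x ⋯ σ_{i_m}` -/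
def morW (w : List (Fin θ)) (x : X) : homW G R (wsrc G w x) x :=
  (Quotient.functor (wrel G R)).map (pathOf G w x)

/-- the generator `σ_i^x : ρ_i(x) → x` in the Weyl groupoid -/
def genW (x : X) (i : Fin θ) : homW G R (G.ρ i x) x :=
  (Quotient.functor (wrel G R)).map (genArrow G x i)

/-- transport a morphism of the Weyl groupoid along an equality of sources -/
def castW {a b c : X} (h : a = b) (f : homW G R a c) : homW G R b c := by
  subst h; exact f

/-- transport a morphism of the Weyl groupoid along an equality of targets -/
def castTgt {a c c' : X} (h : c = c') (f : homW G R a c) : homW G R a c' := by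
  subst h; exact f

/-- the length `ℓ(f)` of a morphism of the Weyl groupoid -/
def len {y x : X} (f : homW G R y x) : ℕ :=
  sInf {n | ∃ w : List (Fin θ), w.length = n ∧
    ∃ h : wsrc G w x = y, castW G R h (morW G R w x) = f}

/-- `w` is a reduced expression of the morphism `f ∈ 𝒲(y,x)` -/
def IsRedEx (w : List (Fin θ)) {y x : X} (f : homW G R y x) : Prop :=
  ∃ h : wsrc G w x = y, castW G R h (morW G R w x) = f ∧ w.length = len G R f


section NilHecke

variable (𝕂 : Type) [CommRing 𝕂]

/-- the generator `e^x` of the free algebra -/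
def eF (x : X) : FreeAlgebra 𝕂 (X ⊕ X × Fin θ) := FreeAlgebra.ι 𝕂 (Sum.inl x)

/-- the generator `n_i^x` of the free algebra -/
def nF (x : X) (i : Fin θ) : FreeAlgebra 𝕂 (X ⊕ X × Fin θ) := FreeAlgebra.ι 𝕂 (Sum.inr (x, i))

/-- the word `n_{i_1}^x n_{i_2} ⋯ n_{i_m}` in the free algebra
(superscripts determined by composability) -/
def nWF (G : SCG θ X) (𝕂 : Type) [CommRing 𝕂] :
    List (Fin θ) → X → FreeAlgebra 𝕂 (X ⊕ X × Fin θ)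
  | [], _ => 1
  | i :: l, x => nF 𝕂 x i * nWF G 𝕂 l (G.ρ i x)

/-- The defining relations of the nil-Hecke algebra of `(X, ρ, 𝒞)`. -/
inductive nrel (R : GRS G) (𝕂 : Type) [CommRing 𝕂] :
    FreeAlgebra 𝕂 (X ⊕ X × Fin θ) → FreeAlgebra 𝕂 (X ⊕ X × Fin θ) → Prop
  | orth (x y : X) (h : x ≠ y) : nrel R 𝕂 (eF 𝕂 x * eF 𝕂 y) 0
  | idem (x : X) : nrel R 𝕂 (eF 𝕂 x * eF 𝕂 x) (eF 𝕂 x)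
  | total : nrel R 𝕂 (∑ x : X, eF 𝕂 x) 1
  | unit_right (x : X) (i : Fin θ) : nrel R 𝕂 (nF 𝕂 x i * eF 𝕂 (G.ρ i x)) (nF 𝕂 x i)
  | unit_left (x : X) (i : Fin θ) : nrel R 𝕂 (eF 𝕂 x * nF 𝕂 x i) (nF 𝕂 x i)
  | nil (x : X) (i : Fin θ) : nrel R 𝕂 (nF 𝕂 (G.ρ i x) i * nF 𝕂 x i) 0
  | braid (x : X) (i j : Fin θ) (hij : i ≠ j) :
      nrel R 𝕂 (nWF G 𝕂 (altWord i j (mnum G R x i j)) x)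
        (nWF G 𝕂 (altWord j i (mnum G R x i j)) x)

/-- The nil-Hecke algebra `𝒩(X, ρ, 𝒞)` of a Weyl groupoid over `𝕂`. -/
def NH := RingQuot (nrel G R 𝕂)

instance : Ring (NH G R 𝕂) := inferInstanceAs (Ring (RingQuot (nrel G R 𝕂)))
instance : Algebra 𝕂 (NH G R 𝕂) := inferInstanceAs (Algebra 𝕂 (RingQuot (nrel G R 𝕂)))

/-- the generator `e^x` of the nil-Hecke algebra -/
def eN (x : X) : NH G R 𝕂 := RingQuot.mkAlgHom 𝕂 (nrel G R 𝕂) (eF 𝕂 x)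

/-- the generator `n_i^x` of the nil-Hecke algebra -/
def nN (x : X) (i : Fin θ) : NH G R 𝕂 := RingQuot.mkAlgHom 𝕂 (nrel G R 𝕂) (nF 𝕂 x i)

/-- the word `n_{i_1}^x n_{i_2} ⋯ n_{i_m}` in the nil-Hecke algebra -/
def nW (w : List (Fin θ)) (x : X) : NH G R 𝕂 := RingQuot.mkAlgHom 𝕂 (nrel G R 𝕂) (nWF G 𝕂 w x)

/-- the set of morphisms of the Weyl groupoid -/
def Mor := Σ (y : X) (x : X), homW G R y x

/-- the free `𝕂`-module `𝕂𝒲` on the set of morphisms of the Weyl groupoid -/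
abbrev KW := Mor G R →₀ 𝕂

/-- the endomorphism `E^x` of `𝕂𝒲` -/
def Emap (x : X) : KW G R 𝕂 →ₗ[𝕂] KW G R 𝕂 :=
  Finsupp.lift (KW G R 𝕂) 𝕂 (Mor G R)
    (fun m => if m.2.1 = x then Finsupp.single m 1 else 0)

/-- the value of the endomorphism `L_i^x` of `𝕂𝒲` on a basis morphism -/
def Lval (x : X) (i : Fin θ) (m : Mor G R) : KW G R 𝕂 :=
  if h : m.2.1 = G.ρ i x then
    (let f' : homW G R m.1 x := castTgt G R h m.2.2 ≫ genW G R x i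
     if len G R m.2.2 < len G R f' then Finsupp.single ⟨m.1, x, f'⟩ 1 else 0)
  else 0

/-- the endomorphism `L_i^x` of `𝕂𝒲` -/
def Lmap (x : X) (i : Fin θ) : KW G R 𝕂 →ₗ[𝕂] KW G R 𝕂 :=
  Finsupp.lift (KW G R 𝕂) 𝕂 (Mor G R) (Lval G R 𝕂 x i)

end NilHecke

end WeylGroupoid


namespace WeylGroupoid

variable {θ : ℕ} {X : Type} [Fintype X] [DecidableEq X]

/-- The ring automorphism of `𝕂 = ℤ[t_1,…,t_θ]` induced by the reflection `s_i^x`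
(via the identification `α_i ↦ t_i`): `t_j ↦ t_j - c^x_{ij} t_i`. -/
def sAct (G : SCG θ X) (x : X) (i : Fin θ) :
    MvPolynomial (Fin θ) ℤ →+* MvPolynomial (Fin θ) ℤ :=
  (MvPolynomial.aeval fun j => MvPolynomial.X j - MvPolynomial.C (G.C x i j) * MvPolynomial.X i :
    MvPolynomial (Fin θ) ℤ →ₐ[ℤ] MvPolynomial (Fin θ) ℤ).toRingHom

/-- the linear polynomial attached to `v ∈ ℤ^θ` under `α_i ↦ t_i` -/
def lin {θ : ℕ} (v : Fin θ → ℤ) : MvPolynomial (Fin θ) ℤ := ∑ k, MvPolynomial.C (v k) * MvPolynomial.X k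

/-- `h_i^x(t) = e^x + t n_i^x` if `ρ_i(x) = x`, and `h_i^x(t) = t n_i^x` otherwise. -/
def hGen (G : SCG θ X) (R : GRS G) (x : X) (i : Fin θ) (t : MvPolynomial (Fin θ) ℤ) :
    NH G R (MvPolynomial (Fin θ) ℤ) :=
  if G.ρ i x = x then eN G R _ x + t • nN G R _ x i else t • nN G R _ x i

/-- The product `h_{i_1}^{x_1}(s·t_{i_1}) h_{i_2}^{x_2}((s∘s_{i_1}^{x_1})·t_{i_2}) ⋯`;
with `s = id` this is
`h_{i_1}^{x_1}(t_{i_1}) h_{i_2}^{x_2}(s_{i_1}^{x_1}·t_{i_2}) ⋯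
 h_{i_m}^{x_m}(s_{i_1}^{x_1}⋯s_{i_{m-1}}·t_{i_m})`,
where `x_{k+1} = ρ_{i_k}(x_k)`. -/
def hP (G : SCG θ X) (R : GRS G) :
    List (Fin θ) → X → (MvPolynomial (Fin θ) ℤ →+* MvPolynomial (Fin θ) ℤ) →
      NH G R (MvPolynomial (Fin θ) ℤ)
  | [], _, _ => 1
  | i :: l, x, s => hGen G R x i (s (MvPolynomial.X i)) * hP G R l (G.ρ i x) (s.comp (sAct G x i))

/-- the composite ring automorphism `s_{i_1}^{x_1} s_{i_2}^{x_2} ⋯ s_{i_m}^{x_m}` of `𝕂`,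
where `x_{k+1} = ρ_{i_k}(x_k)` -/
def sComp (G : SCG θ X) :
    List (Fin θ) → X → (MvPolynomial (Fin θ) ℤ →+* MvPolynomial (Fin θ) ℤ)
  | [], _ => RingHom.id _
  | i :: l, x => (sAct G x i).comp (sComp G l (G.ρ i x))

end WeylGroupoid

namespace WeylGroupoid

section Words

variable {θ : ℕ} {X : Type} [Fintype X] [DecidableEq X] (G : SCG θ X) (R : GRS G)

/-- `w` is a (not necessarily reduced) expression of the morphism `f`. -/
def IsExpr (w : List (Fin θ)) {y x : X} (f : homW G R y x) : Prop :=
  ∃ h : wsrc G w x = y, castW G R h (morW G R w x) = f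

/-- Composition in the Weyl groupoid, on the hom-sets `homW`. -/
def compW {a b c : X} (f : homW G R a b) (g : homW G R b c) : homW G R a c :=
  (f ≫ g : objW G R a ⟶ objW G R c)

theorem compW_assoc {a b c d : X} (f : homW G R a b) (g : homW G R b c) (k : homW G R c d) :
    compW G R (compW G R f g) k = compW G R f (compW G R g k) :=
  Category.assoc _ _ _

theorem compW_id {a b : X} (f : homW G R a b) : compW G R f (𝟙 (objW G R b)) = f :=
  Category.comp_id _

theorem map_castSrc {a b c : X} (h : a = b) (f : pob G a ⟶ pob G c) :
    (Quotient.functor (wrel G R)).map (castSrc G h f) =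
      castW G R h ((Quotient.functor (wrel G R)).map f) := by
  subst h; rfl

theorem castW_morW_cons (i : Fin θ) (l : List (Fin θ)) {x y : X}
    (h : wsrc G l (G.ρ i x) = y) :
    castW G R (a := wsrc G (i :: l) x) h (morW G R (i :: l) x) =
      compW G R (castW G R h (morW G R l (G.ρ i x))) (genW G R x i) := by
  subst h
  exact (Quotient.functor (wrel G R)).map_comp _ _

theorem castW_morW_singleton (i : Fin θ) {x y : X} (h : G.ρ i x = y) :
    castW G R (a := wsrc G [i] x) h (morW G R [i] x) = castW G R h (genW G R x i) := by
  subst h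
  exact congrArg (Quotient.functor (wrel G R)).map (Category.id_comp _)

variable {G R}

theorem IsExpr.cons {w : List (Fin θ)} {y x : X} {i : Fin θ} {f : homW G R y (G.ρ i x)}
    (hf : IsExpr G R w f) :
    IsExpr G R (i :: w) (compW G R f (genW G R x i)) := by
  obtain ⟨h, rfl⟩ := hf
  exact ⟨h, castW_morW_cons G R i w h⟩

variable (G R)

theorem exists_pathOf_eq {a b : Obj G} (p : Quiver.Path a b) :
    ∃ (w : List (Fin θ)) (h : wsrc G w b = a), castSrc G h (pathOf G w b) = p := by
  induction p with
  | nil => exact ⟨[], rfl, rfl⟩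
  | @cons b c p e ih =>
    obtain ⟨i, hi⟩ := e
    obtain ⟨w, h, hw⟩ := ih
    change G.ρ i c = b at hi
    subst hi
    subst h
    subst hw
    exact ⟨i :: w, rfl, rfl⟩

theorem exists_isExpr {y x : X} (f : homW G R y x) : ∃ w, IsExpr G R w f := by
  obtain ⟨p, rfl⟩ := (Quotient.functor (wrel G R)).map_surjective f
  obtain ⟨w, h, hw⟩ := exists_pathOf_eq G p
  exact ⟨w, h, by rw [← hw]; exact (map_castSrc G R h _).symm⟩

theorem exists_isExpr_length_eq_len {y x : X} (f : homW G R y x) :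
    ∃ w, IsExpr G R w f ∧ w.length = len G R f := by
  obtain ⟨w₀, h₀⟩ := exists_isExpr G R f
  obtain ⟨w, hl, hw⟩ := Nat.sInf_mem
    (s := {n | ∃ w : List (Fin θ), w.length = n ∧
      ∃ h : wsrc G w x = y, castW G R h (morW G R w x) = f}) ⟨_, w₀, rfl, h₀⟩
  exact ⟨w, hw, hl⟩

variable {G R} in
theorem IsExpr.len_le {w : List (Fin θ)} {y x : X} {f : homW G R y x}
    (hf : IsExpr G R w f) : len G R f ≤ w.length :=
  Nat.sInf_le ⟨w, rfl, hf⟩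

theorem mnum_self (x : X) (i : Fin θ) : mnum G R x i i = 1 := by
  have hs : R.Δ x ∩ pairCone θ i i = {al θ i} := by
    ext v
    have hv := Set.ext_iff.1 (R.simple x i) v
    simp only [Set.mem_inter_iff, Set.mem_ofPred_eq, Set.mem_insert_iff,
      Set.mem_singleton_iff] at hv ⊢
    constructor
    · rintro ⟨hΔ, a, b, hab⟩
      rcases hv.1 ⟨hΔ, a + b, by rw [hab, add_smul]⟩ with h | h
      · exact h
      · have := congrFun (hab.symm.trans h) i
        simp [al] at this
        omega
    · intro h
      exact ⟨(hv.2 (Or.inl h)).1, 1, 0, by simp [h]⟩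
  rw [mnum, hs, Set.ncard_singleton]

theorem genW_compW_genW (a : X) (i : Fin θ) (h : G.ρ i (G.ρ i a) = a) :
    compW G R (castW G R h (genW G R (G.ρ i a) i)) (genW G R a i) = 𝟙 (objW G R a) := by
  have key : ∀ n, n = 1 → mnum G R a i i = n →
      ∀ h : wsrc G (altWord i i (2 * n)) a = a,
        castW G R h (morW G R (altWord i i (2 * n)) a) = 𝟙 (objW G R a) := by
    rintro n - rfl h
    exact (map_castSrc G R h _).symm.trans
      (CategoryTheory.Quotient.sound _ (wrel.rel a i i h))
  rw [← castW_morW_singleton]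
  exact (castW_morW_cons G R i [i] h).symm.trans (key 1 rfl (mnum_self G R a i) h)

theorem castTgt_compW {a b c d : X} (h : c = d) (f : homW G R a b) (g : homW G R b c) :
    castTgt G R h (compW G R f g) = compW G R f (castTgt G R h g) := by
  subst h; rfl

theorem castTgt_genW {x x' : X} (h : x = x') {i : Fin θ} :
    castTgt G R h (genW G R x i) = castW G R (congrArg (G.ρ i) h.symm) (genW G R x' i) := by
  subst h; rfl

variable {G R}

theorem IsExpr.castTgt {w : List (Fin θ)} {y x x' : X} {f : homW G R y x}
    (hf : IsExpr G R w f) (h : x = x') : IsExpr G R w (castTgt G R h f) := by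
  subst h; exact hf

theorem IsExpr.cons_of_comp {w : List (Fin θ)} {y x : X} {i : Fin θ}
    {f : homW G R y (G.ρ i x)}
    (hf : IsExpr G R w (compW G R f (genW G R x i))) :
    IsExpr G R (i :: w) f := by
  have hi := G.invol i x
  have hw := (hf.castTgt hi.symm).cons
  rwa [castTgt_compW, compW_assoc, castTgt_genW G R hi.symm, genW_compW_genW,
    compW_id] at hw

variable (G R)

theorem length_pathOf (w : List (Fin θ)) (x : X) :
    Quiver.Path.length (pathOf G w x) = w.length := by
  induction w generalizing x with
  | nil => rfl
  | cons i l ih => exact congrArg (· + 1) (ih _)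

theorem length_castSrc {a b c : X} (h : a = b) (f : pob G a ⟶ pob G c) :
    Quiver.Path.length (castSrc G h f) = Quiver.Path.length f := by
  subst h; rfl

theorem length_altWord (i j : Fin θ) (n : ℕ) : (altWord i j n).length = n := by
  induction n generalizing i j with
  | zero => rfl
  | succ n ih => exact congrArg (· + 1) (ih _ _)

/-- The parity of the length, as a functor on the free category. -/
def pathParity : Paths (Obj G) ⥤ SingleObj (Multiplicative (ZMod 2)) where
  obj _ := SingleObj.star _
  map p := Multiplicative.ofAdd ((Quiver.Path.length p : ℕ) : ZMod 2)
  map_id _ := by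
    change Multiplicative.ofAdd (((0 : ℕ)) : ZMod 2) = 1
    simp
  map_comp p q := by
    refine (congrArg (fun n : ℕ => Multiplicative.ofAdd (n : ZMod 2))
      (Quiver.Path.length_comp p q)).trans ?_
    rw [Nat.cast_add, add_comm, ofAdd_add]
    rfl

/-- The parity of the length, as a functor on the Weyl groupoid. -/
def parity : CategoryTheory.Quotient (wrel G R) ⥤ SingleObj (Multiplicative (ZMod 2)) :=
  CategoryTheory.Quotient.lift _ (pathParity G) (by
    rintro _ _ _ _ ⟨x, i, j, h⟩
    change Multiplicative.ofAdd _ = Multiplicative.ofAdd (((0 : ℕ)) : ZMod 2)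
    rw [length_castSrc, length_pathOf, length_altWord, Nat.cast_mul,
      (ZMod.natCast_eq_zero_iff 2 2).2 dvd_rfl, zero_mul, Nat.cast_zero])

variable {G R}

theorem IsExpr.parity_map {w : List (Fin θ)} {y x : X} {f : homW G R y x}
    (hf : IsExpr G R w f) :
    (parity G R).map f = Multiplicative.ofAdd ((w.length : ℕ) : ZMod 2) := by
  obtain ⟨rfl, rfl⟩ := hf
  exact congrArg (fun n : ℕ => Multiplicative.ofAdd (n : ZMod 2)) (length_pathOf G w x)

theorem IsExpr.length_mod_two_eq {w w' : List (Fin θ)} {y x : X} {f : homW G R y x}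
    (hf : IsExpr G R w f) (hf' : IsExpr G R w' f) : w.length % 2 = w'.length % 2 :=
  (ZMod.natCast_eq_natCast_iff' _ _ 2).1 (hf.parity_map.symm.trans hf'.parity_map)

end Words

section NilHecke

variable {θ : ℕ} {X : Type} [Fintype X] [DecidableEq X] (G : SCG θ X) (R : GRS G)
  (𝕂 : Type) [CommRing 𝕂]

theorem nN_mul_eN (x : X) (i : Fin θ) :
    nN G R 𝕂 x i * eN G R 𝕂 (G.ρ i x) = nN G R 𝕂 x i :=
  (map_mul (RingQuot.mkAlgHom 𝕂 (nrel G R 𝕂)) _ _).symm.trans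
    (RingQuot.mkAlgHom_rel 𝕂 (nrel.unit_right x i))

theorem eN_mul_nN (x : X) (i : Fin θ) :
    eN G R 𝕂 x * nN G R 𝕂 x i = nN G R 𝕂 x i :=
  (map_mul (RingQuot.mkAlgHom 𝕂 (nrel G R 𝕂)) _ _).symm.trans
    (RingQuot.mkAlgHom_rel 𝕂 (nrel.unit_left x i))

theorem eN_mul_eN_of_ne {x y : X} (h : x ≠ y) : eN G R 𝕂 x * eN G R 𝕂 y = 0 :=
  (map_mul (RingQuot.mkAlgHom 𝕂 (nrel G R 𝕂)) _ _).symm.trans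
    ((RingQuot.mkAlgHom_rel 𝕂 (nrel.orth x y h)).trans (map_zero _))

theorem nN_mul_nN (x : X) (i : Fin θ) :
    nN G R 𝕂 x i * nN G R 𝕂 (G.ρ i x) i = 0 := by
  have h := nrel.nil (R := R) (𝕂 := 𝕂) (G.ρ i x) i
  rw [G.invol] at h
  exact (map_mul (RingQuot.mkAlgHom 𝕂 (nrel G R 𝕂)) _ _).symm.trans
    ((RingQuot.mkAlgHom_rel 𝕂 h).trans (map_zero _))

theorem nW_nil (x : X) : nW G R 𝕂 [] x = 1 :=
  map_one (RingQuot.mkAlgHom 𝕂 (nrel G R 𝕂))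

theorem nW_cons (i : Fin θ) (l : List (Fin θ)) (x : X) :
    nW G R 𝕂 (i :: l) x = nN G R 𝕂 x i * nW G R 𝕂 l (G.ρ i x) :=
  map_mul (RingQuot.mkAlgHom 𝕂 (nrel G R 𝕂)) _ _

/-- `T` assigns to every morphism the product of the `n_i` along any reduced expression, with
`T_{id_x} = e^x`; then `T_u = e^z nW(w)` for every reduced expression `w` of `u ∈ 𝒲(y,z)`. -/
theorem T_eq_eN_mul_nW {T : ∀ y x : X, homW G R y x → NH G R 𝕂}
    (hT : ∀ (y x : X) (f : homW G R y x) (w : List (Fin θ)) (h : wsrc G w x = y),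
      castW G R h (morW G R w x) = f → w.length = len G R f → 0 < w.length →
      T y x f = nW G R 𝕂 w x)
    (hTid : ∀ x : X, T x x (𝟙 (objW G R x)) = eN G R 𝕂 x)
    {y z : X} {u : homW G R y z} {w : List (Fin θ)} (hw : IsExpr G R w u)
    (hl : w.length = len G R u) : T y z u = eN G R 𝕂 z * nW G R 𝕂 w z := by
  obtain ⟨h, hu⟩ := hw
  cases w with
  | nil =>
    change z = y at h
    subst h
    rw [nW_nil, mul_one, ← hTid, ← hu]
    rfl
  | cons i l =>
    rw [hT y z u (i :: l) h hu hl (by simp), nW_cons, ← mul_assoc, eN_mul_nN]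

end NilHecke

/-- **Products `n_i^x T_u` in the nil-Hecke algebra.**
Let `u ∈ 𝒲(y,z)` with `ℓ(u) = m`, and let `x ∈ X`, `i ∈ I`.  If `z = ρ_i(x)` and
`ℓ(σ_i^x u) = m + 1` then `n_i^x T_u = T_{σ_i^x u}`; otherwise (`z ≠ ρ_i(x)`, or
`z = ρ_i(x)` and `ℓ(σ_i^x u) < m + 1`) one has `n_i^x T_u = 0`. -/
theorem nGen_mul_T {θ : ℕ} {X : Type} [Fintype X] [DecidableEq X]
    (G : SCG θ X) (R : GRS G) (𝕂 : Type) [CommRing 𝕂]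
    (T : ∀ y x : X, homW G R y x → NH G R 𝕂)
    (hT : ∀ (y x : X) (f : homW G R y x) (w : List (Fin θ)) (h : wsrc G w x = y),
      castW G R h (morW G R w x) = f → w.length = len G R f → 0 < w.length →
      T y x f = nW G R 𝕂 w x)
    (hTid : ∀ x : X, T x x (𝟙 (objW G R x)) = eN G R 𝕂 x)
    (y z : X) (u : homW G R y z) (m : ℕ) (hm : len G R u = m)
    (x : X) (i : Fin θ) :
    (∀ h : z = G.ρ i x, len G R (castTgt G R h u ≫ genW G R x i) = m + 1 →
      nN G R 𝕂 x i * T y z u = T y x (castTgt G R h u ≫ genW G R x i)) ∧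
    (z ≠ G.ρ i x → nN G R 𝕂 x i * T y z u = 0) ∧
    (∀ h : z = G.ρ i x, len G R (castTgt G R h u ≫ genW G R x i) < m + 1 →
      nN G R 𝕂 x i * T y z u = 0) := by
  obtain ⟨w, hw, hwl⟩ := exists_isExpr_length_eq_len G R u
  have hTu := T_eq_eN_mul_nW G R 𝕂 hT hTid hw hwl
  refine ⟨?_, ?_, ?_⟩
  · rintro rfl hl
    obtain ⟨h, hf⟩ := hw.cons (x := x) (i := i)
    rw [hTu, ← mul_assoc, nN_mul_eN, ← nW_cons]
    exact (hT _ _ _ (i :: w) h hf (by rw [List.length_cons, hwl, hm]; exact hl.symm)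
      (by simp)).symm
  · intro h
    rw [hTu, ← mul_assoc, ← nN_mul_eN, mul_assoc (nN G R 𝕂 x i),
      eN_mul_eN_of_ne G R 𝕂 h.symm, mul_zero, zero_mul]
  · rintro rfl hl
    obtain ⟨v, hv, hvl⟩ := exists_isExpr_length_eq_len G R
      (compW G R u (genW G R x i))
    have hl' : v.length < m + 1 := hvl.trans_lt hl
    have hiv := hv.cons_of_comp
    have hpar := hiv.length_mod_two_eq hw
    have hle := hiv.len_le
    rw [List.length_cons] at hpar hle
    have hlen : (i :: v).length = len G R u := by
      rw [List.length_cons]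
      omega
    obtain ⟨h, hf⟩ := hiv
    rw [hT _ _ u (i :: v) h hf hlen (by simp), nW_cons, ← mul_assoc, nN_mul_nN, zero_mul]

end WeylGroupoid
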